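/- Assume the λυ-calculus preserves strong normalization (PSN): every substitution-free λυ-term that is strongly normalizing for de Bruijn β-reduction is strongly normalizing for λυ-reduction. Then every simply typed λυ-term is strongly normalizing for λυ-reduction. -/

import Mathlib

namespace LambdaUpsilon

/-- Simple types. -/
inductive Ty : Type
  | base : Ty
  | arrow : Ty → Ty → Ty

mutual
/-- Terms of the λυ-calculus (de Bruijn).  `var k` represents the de Bruijn
index `k+1` (indices start at 1 in the paper). -/
inductive Tm : Type
  | var : ℕ → Tm
  | app : Tm → Tm → Tm
  | lam : Tm → Tm
  | sub : Tm → Sb → Tm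

/-- Substitutions of the λυ-calculus: `slash t` is `t/`, `lift s` is `⇑(s)`
and `shift` is `↑`. -/
inductive Sb : Type
  | slash : Tm → Sb
  | lift : Sb → Sb
  | shift : Sb
end

/-- The re-indexing function `⇑↑ᵢ`:  `⇑↑ᵢ(n) = n+1` if `n > i`, `n` otherwise,
homomorphic on applications, `⇑↑ᵢ(λt) = λ⇑↑_{i+1}(t)`, extended to simple
substitutions by `⇑↑ᵢ(t[u/]) = ⇑↑_{i+1}(t)[⇑↑ᵢ(u)/]`. -/
def liftshift (i : ℕ) : Tm → Tm
  | .var k => if i ≤ k then .var (k + 1) else .var k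
  | .app t u => .app (liftshift i t) (liftshift i u)
  | .lam t => .lam (liftshift (i + 1) t)
  | .sub t (.slash u) => .sub (liftshift (i + 1) t) (.slash (liftshift i u))
  | .sub t s => .sub t s

/-- The re-indexing function `↑ⁱ`, i.e. `⇑↑₀` applied `i` times. -/
def shiftN (i : ℕ) (t : Tm) : Tm := (liftshift 0)^[i] t

/-- The re-indexing function `⇑/ᵢ`:  `⇑/ᵢ(n) = n` if `n > i+1`, `1` if
`n = i+1`, `n+1` if `n ≤ i`, homomorphic on applications,
`⇑/ᵢ(λt) = λ⇑/_{i+1}(t)`, extended to simple substitutions by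
`⇑/ᵢ(t[u/]) = ⇑/_{i+1}(t)[⇑/ᵢ(u)/]`. -/
def liftcons (i : ℕ) : Tm → Tm
  | .var k => if i < k then .var k else if k = i then .var 0 else .var (k + 1)
  | .app t u => .app (liftcons i t) (liftcons i u)
  | .lam t => .lam (liftcons (i + 1) t)
  | .sub t (.slash u) => .sub (liftcons (i + 1) t) (.slash (liftcons i u))
  | .sub t s => .sub t s

/-- Substitution-free terms. -/
inductive Pure : Tm → Prop
  | var (k : ℕ) : Pure (.var k)
  | app {t u : Tm} : Pure t → Pure u → Pure (.app t u)
  | lam {t : Tm} : Pure t → Pure (.lam t)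

/-- Terms containing no `⇑` and no `↑`: every substitution occurring in them
is a simple substitution `[u/]`. -/
inductive Simple : Tm → Prop
  | var (k : ℕ) : Simple (.var k)
  | app {t u : Tm} : Simple t → Simple u → Simple (.app t u)
  | lam {t : Tm} : Simple t → Simple (.lam t)
  | sub {t u : Tm} : Simple t → Simple u → Simple (.sub t (.slash u))

mutual
/-- The simple typing system of λυ: `TypT Γ t A` is `Γ ⊢ t : A`. -/
inductive TypT : List Ty → Tm → Ty → Prop
  | var {Γ : List Ty} {k : ℕ} {A : Ty} : Γ[k]? = some A → TypT Γ (.var k) A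
  | app {Γ : List Ty} {t u : Tm} {A B : Ty} :
      TypT Γ t (.arrow B A) → TypT Γ u B → TypT Γ (.app t u) A
  | lam {Γ : List Ty} {t : Tm} {A B : Ty} :
      TypT (B :: Γ) t A → TypT Γ (.lam t) (.arrow B A)
  | sub {Γ Γ' : List Ty} {t : Tm} {s : Sb} {A : Ty} :
      TypS Γ s Γ' → TypT Γ' t A → TypT Γ (.sub t s) A

/-- Typing of substitutions: `TypS Γ s Γ'` is `Γ ⊢ s ▷ Γ'`. -/
inductive TypS : List Ty → Sb → List Ty → Prop
  | slash {Γ : List Ty} {t : Tm} {A : Ty} :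
      TypT Γ t A → TypS Γ (.slash t) (A :: Γ)
  | shift {Γ : List Ty} {A : Ty} : TypS (A :: Γ) .shift Γ
  | lift {Γ Γ' : List Ty} {s : Sb} {A B : Ty} :
      TypS Γ s (B :: Γ') → TypS (A :: Γ) (.lift s) (A :: B :: Γ')
end

mutual
/-- The expansion `Ateb` from λυ-terms to substitution-free terms. -/
def Ateb : Tm → Tm
  | .var k => .var k
  | .app t u => .app (Ateb t) (Ateb u)
  | .lam t => .lam (Ateb t)
  | .sub t s => AtebS 0 (Ateb t) s

/-- Auxiliary function: `AtebS i a s` computes the expansion of `a[⇑ⁱ(s)]`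
for `a` an already expanded term. -/
def AtebS : ℕ → Tm → Sb → Tm
  | i, a, .slash u => .app (.lam (liftcons i a)) (shiftN i (Ateb u))
  | i, a, .shift => liftshift i a
  | i, a, .lift s => AtebS (i + 1) a s
end

mutual
/-- The flattening function `ol`. -/
def ol : Tm → Tm
  | .var k => .var k
  | .app t u => .app (ol t) (ol u)
  | .lam t => .lam (ol t)
  | .sub t s => olS 0 (ol t) s

/-- Auxiliary function: `olS i a s` computes the flattening of `a[⇑ⁱ(s)]`
for `a` an already flattened term. -/
def olS : ℕ → Tm → Sb → Tm
  | i, a, .slash u => .sub (liftcons i a) (.slash (shiftN i (ol u)))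
  | i, a, .shift => liftshift i a
  | i, a, .lift s => olS (i + 1) a s
end

mutual
/-- The rule `B` of λυ, closed under arbitrary contexts. -/
inductive StepB : Tm → Tm → Prop
  | beta {t u : Tm} : StepB (.app (.lam t) u) (.sub t (.slash u))
  | appl {t t' u : Tm} : StepB t t' → StepB (.app t u) (.app t' u)
  | appr {t u u' : Tm} : StepB u u' → StepB (.app t u) (.app t u')
  | lam {t t' : Tm} : StepB t t' → StepB (.lam t) (.lam t')
  | subt {t t' : Tm} {s : Sb} : StepB t t' → StepB (.sub t s) (.sub t' s)
  | subs {t : Tm} {s s' : Sb} : StepBS s s' → StepB (.sub t s) (.sub t s')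

/-- The rule `B` inside substitutions. -/
inductive StepBS : Sb → Sb → Prop
  | slash {t t' : Tm} : StepB t t' → StepBS (.slash t) (.slash t')
  | lift {s s' : Sb} : StepBS s s' → StepBS (.lift s) (.lift s')
end

mutual
/-- The rules of λυ other than `B` (App, Lambda, FVar, RVar, FVarLift,
RVarLift, VarShift), closed under arbitrary contexts. -/
inductive StepO : Tm → Tm → Prop
  | app_s {t u : Tm} {s : Sb} :
      StepO (.sub (.app t u) s) (.app (.sub t s) (.sub u s))
  | lam_s {t : Tm} {s : Sb} : StepO (.sub (.lam t) s) (.lam (.sub t (.lift s)))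
  | fvar {t : Tm} : StepO (.sub (.var 0) (.slash t)) t
  | rvar {t : Tm} {k : ℕ} : StepO (.sub (.var (k + 1)) (.slash t)) (.var k)
  | fvarlift {s : Sb} : StepO (.sub (.var 0) (.lift s)) (.var 0)
  | rvarlift {s : Sb} {k : ℕ} :
      StepO (.sub (.var (k + 1)) (.lift s)) (.sub (.sub (.var k) s) .shift)
  | varshift {k : ℕ} : StepO (.sub (.var k) .shift) (.var (k + 1))
  | appl {t t' u : Tm} : StepO t t' → StepO (.app t u) (.app t' u)
  | appr {t u u' : Tm} : StepO u u' → StepO (.app t u) (.app t u')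
  | lam {t t' : Tm} : StepO t t' → StepO (.lam t) (.lam t')
  | subt {t t' : Tm} {s : Sb} : StepO t t' → StepO (.sub t s) (.sub t' s)
  | subs {t : Tm} {s s' : Sb} : StepOS s s' → StepO (.sub t s) (.sub t s')

/-- The rules other than `B` inside substitutions. -/
inductive StepOS : Sb → Sb → Prop
  | slash {t t' : Tm} : StepO t t' → StepOS (.slash t) (.slash t')
  | lift {s s' : Sb} : StepOS s s' → StepOS (.lift s) (.lift s')
end

/-- The full λυ-reduction: the union of `B` and the other rules. -/
def Step (t u : Tm) : Prop := StepB t u ∨ StepO t u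

mutual
/-- The skeleton order `≼` on terms. -/
inductive PrecT : Tm → Tm → Prop
  | var (n m : ℕ) : PrecT (.var n) (.var m)
  | app {t t' u u' : Tm} : PrecT t t' → PrecT u u' → PrecT (.app t u) (.app t' u')
  | lam {t t' : Tm} : PrecT t t' → PrecT (.lam t) (.lam t')
  | shift_r {t t' : Tm} : PrecT t t' → PrecT t (.sub t' .shift)
  | sub {t t' : Tm} {s s' : Sb} :
      PrecT t t' → PrecS s s' → PrecT (.sub t s) (.sub t' s')

/-- The skeleton order `≼` on substitutions. -/
inductive PrecS : Sb → Sb → Prop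
  | shift : PrecS .shift .shift
  | slash {t t' : Tm} : PrecT t t' → PrecS (.slash t) (.slash t')
  | lift {s s' : Sb} : PrecS s s' → PrecS (.lift s) (.lift s')
  | lift_r {s s' : Sb} : PrecS s s' → PrecS s (.lift s')
end

/-- The relation `⋖` : `u ⋖ t` iff `ol u = ol t` and `u ≼ t`. -/
def Lessdot (u t : Tm) : Prop := ol u = ol t ∧ PrecT u t

/-- Meta-level de Bruijn substitution, used for β-reduction on pure terms:
`bsub k u t` substitutes `u` for the index `k+1` in `t`. -/
def bsub (k : ℕ) (u : Tm) : Tm → Tm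
  | .var n => if n = k then shiftN k u else if k < n then .var (n - 1) else .var n
  | .app t v => .app (bsub k u t) (bsub k u v)
  | .lam t => .lam (bsub (k + 1) u t)
  | .sub t s => .sub (bsub k u t) s

/-- β-reduction on pure (substitution-free) de Bruijn terms. -/
inductive BetaP : Tm → Tm → Prop
  | beta {t u : Tm} : BetaP (.app (.lam t) u) (bsub 0 u t)
  | appl {t t' u : Tm} : BetaP t t' → BetaP (.app t u) (.app t' u)
  | appr {t u u' : Tm} : BetaP u u' → BetaP (.app t u) (.app t u')
  | lam {t t' : Tm} : BetaP t t' → BetaP (.lam t) (.lam t')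

/-- Strong normalization. -/
def SN (r : Tm → Tm → Prop) (t : Tm) : Prop := Acc (fun a b => r b a) t

/-! ### Termination of the substitution rules -/

mutual
/-- First polynomial weight of a term. -/
def weight : Tm → ℕ
  | .var k => 2 ^ (k + 1)
  | .app t u => weight t + weight u + 1
  | .lam t => weight t + 1
  | .sub t s => weight t * weightS s

/-- First polynomial weight of a substitution. -/
def weightS : Sb → ℕ
  | .slash t => weight t
  | .lift s => weightS s
  | .shift => 2
end

mutual
/-- Second weight of a term, which counts lifts and shifts. -/
def lifts : Tm → ℕ
  | .var _ => 0
  | .app t u => lifts t + lifts u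
  | .lam t => lifts t
  | .sub t s => lifts t + liftsS s

/-- Second weight of a substitution. -/
def liftsS : Sb → ℕ
  | .slash t => lifts t
  | .lift s => liftsS s + 2
  | .shift => 1
end

mutual
theorem two_le_weight : ∀ t : Tm, 2 ≤ weight t
  | .var k => by
    have := Nat.one_le_two_pow (n := k)
    simp only [weight, pow_succ]; omega
  | .app t u => by
    have := two_le_weight t
    simp only [weight]; omega
  | .lam t => by
    have := two_le_weight t
    simp only [weight]; omega
  | .sub t s => by
    have := two_le_weight t
    have := two_le_weightS s
    simp only [weight]; nlinarith

theorem two_le_weightS : ∀ s : Sb, 2 ≤ weightS s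
  | .slash t => by simpa only [weightS] using two_le_weight t
  | .lift s => by simpa only [weightS] using two_le_weightS s
  | .shift => by simp only [weightS]; omega
end

mutual
theorem StepO.weight_lt : ∀ {t t' : Tm}, StepO t t' →
    weight t' < weight t ∨ weight t' = weight t ∧ lifts t' < lifts t
  | _, _, .app_s (s := s) => by
    have := two_le_weightS s
    left; simp only [weight]; nlinarith
  | _, _, .lam_s (s := s) => by
    have := two_le_weightS s
    left; simp only [weight, weightS]; nlinarith
  | _, _, .fvar (t := t) => by
    have := two_le_weight t
    left; simp only [weight, weightS]; omega
  | _, _, .rvar (t := t) (k := k) => by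
    have := two_le_weight t
    have := Nat.one_le_two_pow (n := k + 1)
    left; simp only [weight, weightS, pow_succ _ (k + 1)]; nlinarith
  | _, _, .fvarlift (s := s) => by
    have := two_le_weightS s
    left; simp only [weight, weightS]; omega
  | _, _, .rvarlift => by
    right; simp only [weight, weightS, lifts, liftsS]
    exact ⟨by ring, by omega⟩
  | _, _, .varshift => by
    right; simp only [weight, weightS, lifts, liftsS]
    exact ⟨by ring, by omega⟩
  | _, _, .appl h => by
    have := h.weight_lt
    simp only [weight, lifts]; omega
  | _, _, .appr h => by
    have := h.weight_lt
    simp only [weight, lifts]; omega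
  | _, _, .lam h => by
    have := h.weight_lt
    simp only [weight, lifts]; omega
  | _, _, .subt (s := s) h => by
    have hs := two_le_weightS s
    simp only [weight, lifts]
    rcases h.weight_lt with h | ⟨h, h'⟩
    · left; nlinarith
    · right; rw [h]; omega
  | _, _, .subs (t := t) h => by
    have ht := two_le_weight t
    simp only [weight, lifts]
    rcases h.weight_lt with h | ⟨h, h'⟩
    · left; nlinarith
    · right; rw [h]; omega

theorem StepOS.weight_lt : ∀ {s s' : Sb}, StepOS s s' →
    weightS s' < weightS s ∨ weightS s' = weightS s ∧ liftsS s' < liftsS s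
  | _, _, .slash h => by
    have := h.weight_lt
    simp only [weightS, liftsS]; omega
  | _, _, .lift h => by
    have := h.weight_lt
    simp only [weightS, liftsS]; omega
end

/-! ### Simulation up to a renaming of the free variables -/

/-- Extension of a renaming under a binder. -/
def upRen (ξ : ℕ → ℕ) : ℕ → ℕ
  | 0 => 0
  | k + 1 => ξ k + 1

/-- The sequence sending `0` to `a` and `k + 1` to `f k`. -/
def scons {α : Type} (a : α) (f : ℕ → α) : ℕ → α
  | 0 => a
  | k + 1 => f k

/-- `IsRen s f`: the substitution `s` is of the form `⇑ⁱ(↑)` and denotes the renaming `f`. -/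
inductive IsRen : Sb → (ℕ → ℕ) → Prop
  | shift : IsRen .shift Nat.succ
  | lift {s : Sb} {f : ℕ → ℕ} : IsRen s f → IsRen (.lift s) (upRen f)

/-- `MapsVar n s m`: the substitution `s` sends the variable `n` to the variable `m`, whatever
the terms occurring in `s` are. -/
inductive MapsVar : ℕ → Sb → ℕ → Prop
  | slash (n : ℕ) (t : Tm) : MapsVar (n + 1) (.slash t) n
  | shift (n : ℕ) : MapsVar n .shift (n + 1)
  | liftZero (s : Sb) : MapsVar 0 (.lift s) 0
  | liftSucc {n m : ℕ} {s : Sb} : MapsVar n s m → MapsVar (n + 1) (.lift s) (m + 1)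

mutual
/-- `Sim ρ u t`: the term `u` simulates `t`, whose free variables are renamed by `ρ`, with
possibly fewer shifts and lifts. -/
inductive Sim : (ℕ → ℕ) → Tm → Tm → Prop
  | var {ρ : ℕ → ℕ} {n m : ℕ} : n = ρ m → Sim ρ (.var n) (.var m)
  | app {ρ : ℕ → ℕ} {u u' t t' : Tm} :
      Sim ρ u t → Sim ρ u' t' → Sim ρ (.app u u') (.app t t')
  | lam {ρ : ℕ → ℕ} {u t : Tm} : Sim (upRen ρ) u t → Sim ρ (.lam u) (.lam t)
  | ren {ρ f : ℕ → ℕ} {u t : Tm} {s : Sb} :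
      IsRen s f → Sim (ρ ∘ f) u t → Sim ρ u (.sub t s)
  | sub {ρ ρ' : ℕ → ℕ} {u t : Tm} {w s : Sb} :
      SimS ρ ρ' w s → Sim ρ' u t → Sim ρ (.sub u w) (.sub t s)

/-- `SimS ρ ρ' w s`: the substitution `w` simulates `s`, where `ρ` renames the variables of the
environment of `s` and `ρ'` those of the environment provided by `s`. -/
inductive SimS : (ℕ → ℕ) → (ℕ → ℕ) → Sb → Sb → Prop
  | shift {ρ ρ' : ℕ → ℕ} : (∀ k, ρ (k + 1) = ρ' k + 1) → SimS ρ ρ' .shift .shift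
  | slash {ρ ρ' : ℕ → ℕ} {u t : Tm} :
      ρ' = upRen ρ → Sim ρ u t → SimS ρ ρ' (.slash u) (.slash t)
  | lift {ρ ρ' ξ ξ' : ℕ → ℕ} {w s : Sb} :
      ρ = upRen ξ → ρ' = upRen ξ' → SimS ξ ξ' w s → SimS ρ ρ' (.lift w) (.lift s)
  | lift_r {ρ ρ' : ℕ → ℕ} {w s : Sb} :
      MapsVar (ρ' 0) w (ρ 0) → SimS (ρ ∘ Nat.succ) (ρ' ∘ Nat.succ) w s →
        SimS ρ ρ' w (.lift s)
end

theorem upRen_comp (ρ f : ℕ → ℕ) : upRen ρ ∘ upRen f = upRen (ρ ∘ f) := by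
  funext k; cases k <;> rfl

theorem IsRen.not_stepBS {s s' : Sb} {f : ℕ → ℕ} (h : IsRen s f) : ¬ StepBS s s' := by
  induction h generalizing s' with
  | shift => intro h; cases h
  | lift _ ih => intro h; cases h with | lift h => exact ih h

theorem IsRen.not_stepOS {s s' : Sb} {f : ℕ → ℕ} (h : IsRen s f) : ¬ StepOS s s' := by
  induction h generalizing s' with
  | shift => intro h; cases h
  | lift _ ih => intro h; cases h with | lift h => exact ih h

theorem MapsVar.stepBS {n m : ℕ} {s s' : Sb} (h : MapsVar n s m) (hs : StepBS s s') :
    MapsVar n s' m := by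
  induction h generalizing s' with
  | slash => cases hs; constructor
  | shift => cases hs
  | liftZero => cases hs; constructor
  | liftSucc _ ih => cases hs with | lift hs => exact .liftSucc (ih hs)

theorem MapsVar.stepOS {n m : ℕ} {s s' : Sb} (h : MapsVar n s m) (hs : StepOS s s') :
    MapsVar n s' m := by
  induction h generalizing s' with
  | slash => cases hs; constructor
  | shift => cases hs
  | liftZero => cases hs; constructor
  | liftSucc _ ih => cases hs with | lift hs => exact .liftSucc (ih hs)

open Relation

theorem MapsVar.steps {n m : ℕ} {s : Sb} (h : MapsVar n s m) :
    ReflTransGen StepO (.sub (.var n) s) (.var m) := by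
  induction h with
  | slash => exact .single .rvar
  | shift => exact .single .varshift
  | liftZero => exact .single .fvarlift
  | liftSucc _ ih =>
    exact .head .rvarlift ((ih.lift (Tm.sub · .shift) fun _ _ h => .subt h).tail .varshift)

mutual
theorem StepB.simulate : ∀ {t t' : Tm}, StepB t t' → ∀ {ρ : ℕ → ℕ} {u : Tm}, Sim ρ u t →
    ∃ u', StepB u u' ∧ Sim ρ u' t'
  | _, _, .beta, _, _, .app (.lam h₁) h₂ => ⟨_, .beta, .sub (.slash rfl h₂) h₁⟩
  | _, _, .appl hs, _, _, .app h₁ h₂ =>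
    have ⟨_, hu, h⟩ := hs.simulate h₁
    ⟨_, .appl hu, .app h h₂⟩
  | _, _, .appr hs, _, _, .app h₁ h₂ =>
    have ⟨_, hu, h⟩ := hs.simulate h₂
    ⟨_, .appr hu, .app h₁ h⟩
  | _, _, .lam hs, _, _, .lam h₁ =>
    have ⟨_, hu, h⟩ := hs.simulate h₁
    ⟨_, .lam hu, .lam h⟩
  | _, _, .subt hs, _, _, .ren hr h₁ =>
    have ⟨_, hu, h⟩ := hs.simulate h₁
    ⟨_, hu, .ren hr h⟩
  | _, _, .subt hs, _, _, .sub hw h₁ =>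
    have ⟨_, hu, h⟩ := hs.simulate h₁
    ⟨_, .subt hu, .sub hw h⟩
  | _, _, .subs hs, _, _, .ren hr _ => absurd hs hr.not_stepBS
  | _, _, .subs hs, _, _, .sub hw h₁ =>
    have ⟨_, hu, h⟩ := hs.simulate hw
    ⟨_, .subs hu, .sub h h₁⟩

theorem StepBS.simulate : ∀ {s s' : Sb}, StepBS s s' → ∀ {ρ ρ' : ℕ → ℕ} {w : Sb},
    SimS ρ ρ' w s → ∃ w', StepBS w w' ∧ SimS ρ ρ' w' s'
  | _, _, .slash hs, _, _, _, .slash e h₁ =>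
    have ⟨_, hu, h⟩ := hs.simulate h₁
    ⟨_, .slash hu, .slash e h⟩
  | _, _, .lift hs, _, _, _, .lift e e' h₁ =>
    have ⟨_, hu, h⟩ := hs.simulate h₁
    ⟨_, .lift hu, .lift e e' h⟩
  | _, _, .lift hs, _, _, _, .lift_r hm h₁ =>
    have ⟨_, hu, h⟩ := hs.simulate h₁
    ⟨_, hu, .lift_r (hm.stepBS hu) h⟩
end

theorem MapsVar.stepsOS {n m : ℕ} {s s' : Sb} (h : MapsVar n s m)
    (hs : ReflTransGen StepOS s s') : MapsVar n s' m := by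
  induction hs with
  | refl => exact h
  | tail _ hs ih => exact ih.stepOS hs

mutual
theorem StepO.simulate : ∀ {t t' : Tm}, StepO t t' → ∀ {ρ : ℕ → ℕ} {u : Tm}, Sim ρ u t →
    ∃ u', ReflTransGen StepO u u' ∧ Sim ρ u' t'
  | _, _, .app_s, _, _, .ren hr (.app h₁ h₂) => ⟨_, .refl, .app (.ren hr h₁) (.ren hr h₂)⟩
  | _, _, .app_s, _, _, .sub hw (.app h₁ h₂) =>
    ⟨_, .single .app_s, .app (.sub hw h₁) (.sub hw h₂)⟩
  | _, _, .lam_s, _, _, .ren hr (.lam h) =>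
    ⟨_, .refl, .lam (.ren (.lift hr) (by rwa [upRen_comp]))⟩
  | _, _, .lam_s, _, _, .sub hw (.lam h) =>
    ⟨_, .single .lam_s, .lam (.sub (.lift rfl rfl hw) h)⟩
  | _, _, .fvar, _, _, .sub (.slash e h) (.var e') => by
    subst e e'
    exact ⟨_, .single .fvar, h⟩
  | _, _, .rvar, _, _, .sub (.slash e h) (.var e') => by
    subst e e'
    exact ⟨_, .single .rvar, .var rfl⟩
  | _, _, .fvarlift, _, _, .ren (.lift hr) (.var e) => ⟨_, .refl, .var e⟩
  | _, _, .fvarlift, _, _, .sub (.lift e e' _) (.var h) => by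
    subst e e' h
    exact ⟨_, .single .fvarlift, .var rfl⟩
  | _, _, .fvarlift, _, _, .sub (.lift_r hm _) (.var h) => by
    subst h
    exact ⟨_, hm.steps, .var rfl⟩
  | _, _, .rvarlift, _, _, .ren (.lift hr) (.var e) =>
    ⟨_, .refl, .ren .shift (.ren hr (.var e))⟩
  | _, _, .rvarlift, _, _, .sub (.lift e e' hw) (.var h) => by
    subst e e' h
    exact ⟨_, .single .rvarlift, .sub (.shift fun _ => rfl) (.sub hw (.var rfl))⟩
  | _, _, .rvarlift, _, _, .sub (.lift_r _ hw) (.var h) =>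
    ⟨_, .refl, .ren .shift (.sub hw (.var h))⟩
  | _, _, .varshift, _, _, .ren hr (.var e) => by
    cases hr
    exact ⟨_, .refl, .var e⟩
  | _, _, .varshift, _, _, .sub (.shift e) (.var h) =>
    ⟨_, .single .varshift, .var (by rw [h, e])⟩
  | _, _, .appl hs, _, _, .app h₁ h₂ =>
    have ⟨_, hu, h⟩ := hs.simulate h₁
    ⟨_, hu.lift (Tm.app · _) fun _ _ => .appl, .app h h₂⟩
  | _, _, .appr hs, _, _, .app h₁ h₂ =>
    have ⟨_, hu, h⟩ := hs.simulate h₂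
    ⟨_, hu.lift (Tm.app _) fun _ _ => .appr, .app h₁ h⟩
  | _, _, .lam hs, _, _, .lam h₁ =>
    have ⟨_, hu, h⟩ := hs.simulate h₁
    ⟨_, hu.lift Tm.lam fun _ _ => .lam, .lam h⟩
  | _, _, .subt hs, _, _, .ren hr h₁ =>
    have ⟨_, hu, h⟩ := hs.simulate h₁
    ⟨_, hu, .ren hr h⟩
  | _, _, .subt hs, _, _, .sub hw h₁ =>
    have ⟨_, hu, h⟩ := hs.simulate h₁
    ⟨_, hu.lift (Tm.sub · _) fun _ _ => .subt, .sub hw h⟩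
  | _, _, .subs hs, _, _, .ren hr _ => absurd hs hr.not_stepOS
  | _, _, .subs hs, _, _, .sub hw h₁ =>
    have ⟨_, hu, h⟩ := hs.simulate hw
    ⟨_, hu.lift (Tm.sub _) fun _ _ => .subs, .sub h h₁⟩

theorem StepOS.simulate : ∀ {s s' : Sb}, StepOS s s' → ∀ {ρ ρ' : ℕ → ℕ} {w : Sb},
    SimS ρ ρ' w s → ∃ w', ReflTransGen StepOS w w' ∧ SimS ρ ρ' w' s'
  | _, _, .slash hs, _, _, _, .slash e h₁ =>
    have ⟨_, hu, h⟩ := hs.simulate h₁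
    ⟨_, hu.lift Sb.slash fun _ _ => .slash, .slash e h⟩
  | _, _, .lift hs, _, _, _, .lift e e' h₁ =>
    have ⟨_, hu, h⟩ := hs.simulate h₁
    ⟨_, hu.lift Sb.lift fun _ _ => .lift, .lift e e' h⟩
  | _, _, .lift hs, _, _, _, .lift_r hm h₁ =>
    have ⟨_, hu, h⟩ := hs.simulate h₁
    ⟨_, hu, .lift_r (hm.stepsOS hu) h⟩
end

theorem SN.of_sim {ρ : ℕ → ℕ} {u t : Tm} (hu : SN Step u) (h : Sim ρ u t) : SN Step t := by
  replace hu := hu.transGen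
  induction hu generalizing t with
  | intro u _ ih =>
    induction hp : toLex (weight t, lifts t) using WellFoundedLT.induction generalizing t with
    | ind p ihp =>
      subst hp
      refine ⟨_, fun t' ht => ?_⟩
      rcases ht with ht | ht
      · obtain ⟨u', hu, h'⟩ := ht.simulate h
        exact ih u' (.single (.inl hu)) h'
      · obtain ⟨u', hu, h'⟩ := ht.simulate h
        rcases reflTransGen_iff_eq_or_transGen.1 hu with rfl | hu
        · exact ihp _ (Prod.Lex.toLex_lt_toLex.2 ht.weight_lt) h' rfl
        · exact ih u' (transGen_swap.2 (TransGen.mono (p := Step) (fun _ _ => Or.inr) _ _ hu)) h'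

/-! ### Typed terms are simulated by reducts of typed pure terms -/

theorem Step.appl {t t' u : Tm} : Step t t' → Step (.app t u) (.app t' u) :=
  Or.imp .appl .appl

theorem Step.appr {t u u' : Tm} : Step u u' → Step (.app t u) (.app t u') :=
  Or.imp .appr .appr

theorem Step.lam {t t' : Tm} : Step t t' → Step (.lam t) (.lam t') :=
  Or.imp .lam .lam

/-- `RenTyp Γ Δ ρ`: the renaming `ρ` sends variables of `Γ` to variables of `Δ` of the same
type. -/
def RenTyp (Γ Δ : List Ty) (ρ : ℕ → ℕ) : Prop :=
  ∀ ⦃k : ℕ⦄ ⦃A : Ty⦄, Γ[k]? = some A → Δ[ρ k]? = some A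

theorem RenTyp.up {Γ Δ : List Ty} {ρ : ℕ → ℕ} (h : RenTyp Γ Δ ρ) (A : Ty) :
    RenTyp (A :: Γ) (A :: Δ) (upRen ρ)
  | 0, _, hk => hk
  | k + 1, _, hk => h (k := k) hk

/-- `Expands Δ u A`: the term `u` is a reduct of a pure term of type `A` in `Δ`. -/
def Expands (Δ : List Ty) (u : Tm) (A : Ty) : Prop :=
  ∃ p, Pure p ∧ TypT Δ p A ∧ ReflTransGen Step p u

mutual
theorem TypT.exists_sim : ∀ {Γ : List Ty} {t : Tm} {A : Ty}, TypT Γ t A →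
    ∀ {Δ : List Ty} {ρ : ℕ → ℕ}, RenTyp Γ Δ ρ → ∃ u, Expands Δ u A ∧ Sim ρ u t
  | _, _, _, .var hk, _, _, hρ => ⟨_, ⟨_, .var _, .var (hρ hk), .refl⟩, .var rfl⟩
  | _, _, _, .app h₁ h₂, _, _, hρ =>
    have ⟨_, ⟨_, hp₁, ht₁, hs₁⟩, hu₁⟩ := h₁.exists_sim hρ
    have ⟨_, ⟨_, hp₂, ht₂, hs₂⟩, hu₂⟩ := h₂.exists_sim hρ
    ⟨_, ⟨_, .app hp₁ hp₂, .app ht₁ ht₂,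
      (hs₁.lift (Tm.app · _) fun _ _ => .appl).trans (hs₂.lift (Tm.app _) fun _ _ => .appr)⟩,
      .app hu₁ hu₂⟩
  | _, _, _, .lam h₁, _, _, hρ =>
    have ⟨_, ⟨_, hp₁, ht₁, hs₁⟩, hu₁⟩ := h₁.exists_sim (hρ.up _)
    ⟨_, ⟨_, .lam hp₁, .lam ht₁, hs₁.lift Tm.lam fun _ _ => .lam⟩, .lam hu₁⟩
  | _, _, _, .sub hs h₁, _, _, hρ => by
    rcases hs.exists_sim hρ with ⟨f, hf, hρ'⟩ | ⟨B, b, ρ', ⟨q, hq, htq, hsq⟩, hρ', hw⟩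
    · obtain ⟨u, hu, h⟩ := h₁.exists_sim hρ'
      exact ⟨u, hu, .ren hf h⟩
    · obtain ⟨u, ⟨p, hp, htp, hsp⟩, h⟩ := h₁.exists_sim hρ'
      exact ⟨_, ⟨_, .app (.lam hp) hq, .app (.lam htp) htq,
        (((hsp.lift Tm.lam fun _ _ => .lam).lift (Tm.app · _) fun _ _ => .appl).trans
          (hsq.lift (Tm.app _) fun _ _ => .appr)).tail (.inl .beta)⟩, .sub hw h⟩

theorem TypS.exists_sim : ∀ {Γ : List Ty} {s : Sb} {Γ' : List Ty}, TypS Γ s Γ' →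
    ∀ {Δ : List Ty} {ρ : ℕ → ℕ}, RenTyp Γ Δ ρ →
      (∃ f, IsRen s f ∧ RenTyp Γ' Δ (ρ ∘ f)) ∨
      ∃ B b ρ', Expands Δ b B ∧ RenTyp Γ' (B :: Δ) ρ' ∧ SimS ρ ρ' (.slash b) s
  | _, _, _, .slash h, _, _, hρ =>
    have ⟨_, hb, h'⟩ := h.exists_sim hρ
    .inr ⟨_, _, _, hb, hρ.up _, .slash rfl h'⟩
  | _, _, _, .shift, _, _, hρ => .inl ⟨_, .shift, fun k _ hk => hρ (k := k + 1) hk⟩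
  | _, _, _, .lift h, _, ρ, hρ => by
    have hρ' : RenTyp _ _ (ρ ∘ Nat.succ) := fun k _ hk => hρ (k := k + 1) hk
    rcases h.exists_sim hρ' with ⟨f, hf, hr⟩ | ⟨B, b, ρ', hb, hr, hw⟩
    · refine .inl ⟨_, .lift hf, ?_⟩
      rintro (_ | k) A hk
      · exact hρ (k := 0) hk
      · exact hr hk
    · refine .inr ⟨B, b, scons (ρ 0 + 1) ρ', hb, ?_, .lift_r (.slash _ _) hw⟩
      rintro (_ | k) A hk
      · exact hρ (k := 0) hk
      · exact hr hk
end

/-! ### Parallel renaming and substitution on pure terms -/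

/-- Parallel renaming; explicit substitutions are left unchanged. -/
def ren (ξ : ℕ → ℕ) : Tm → Tm
  | .var k => .var (ξ k)
  | .app t u => .app (ren ξ t) (ren ξ u)
  | .lam t => .lam (ren (upRen ξ) t)
  | .sub t s => .sub t s

/-- Extension of a parallel substitution under a binder. -/
def up (σ : ℕ → Tm) : ℕ → Tm
  | 0 => .var 0
  | k + 1 => ren Nat.succ (σ k)

/-- Parallel substitution; explicit substitutions are left unchanged. -/
def inst (σ : ℕ → Tm) : Tm → Tm
  | .var k => σ k
  | .app t u => .app (inst σ t) (inst σ u)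
  | .lam t => .lam (inst (up σ) t)
  | .sub t s => .sub t s

theorem ren_ren : ∀ (t : Tm) (ξ ζ : ℕ → ℕ), ren ζ (ren ξ t) = ren (ζ ∘ ξ) t
  | .var _, _, _ => rfl
  | .app t u, ξ, ζ => by simp only [ren, ren_ren t, ren_ren u]
  | .lam t, ξ, ζ => by simp only [ren, ren_ren t, upRen_comp]
  | .sub _ _, _, _ => rfl

theorem inst_ren : ∀ (t : Tm) (ξ : ℕ → ℕ) (σ : ℕ → Tm), inst σ (ren ξ t) = inst (σ ∘ ξ) t
  | .var _, _, _ => rfl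
  | .app t u, ξ, σ => by simp only [ren, inst, inst_ren t, inst_ren u]
  | .lam t, ξ, σ => by
    have : up σ ∘ upRen ξ = up (σ ∘ ξ) := by funext k; cases k <;> rfl
    simp only [ren, inst, inst_ren t, this]
  | .sub _ _, _, _ => rfl

theorem ren_inst : ∀ (t : Tm) (σ : ℕ → Tm) (ξ : ℕ → ℕ),
    ren ξ (inst σ t) = inst (ren ξ ∘ σ) t
  | .var _, _, _ => rfl
  | .app t u, σ, ξ => by simp only [ren, inst, ren_inst t, ren_inst u]
  | .lam t, σ, ξ => by
    have : ren (upRen ξ) ∘ up σ = up (ren ξ ∘ σ) := by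
      funext k
      cases k with
      | zero => rfl
      | succ k => simp only [Function.comp, up, ren_ren]; rfl
    simp only [ren, inst, ren_inst t, this]
  | .sub _ _, _, _ => rfl

theorem inst_inst : ∀ (t : Tm) (σ τ : ℕ → Tm), inst τ (inst σ t) = inst (inst τ ∘ σ) t
  | .var _, _, _ => rfl
  | .app t u, σ, τ => by simp only [inst, inst_inst t, inst_inst u]
  | .lam t, σ, τ => by
    have : inst (up τ) ∘ up σ = up (inst τ ∘ σ) := by
      funext k
      cases k with
      | zero => rfl
      | succ k => simp only [Function.comp, up, inst_ren, ren_inst]; rfl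
    simp only [inst, inst_inst t, this]
  | .sub _ _, _, _ => rfl

theorem up_var : up Tm.var = Tm.var := by
  funext k; cases k <;> rfl

theorem inst_var : ∀ t : Tm, inst Tm.var t = t
  | .var _ => rfl
  | .app t u => by simp only [inst, inst_var t, inst_var u]
  | .lam t => by simp only [inst, up_var, inst_var t]
  | .sub _ _ => rfl

theorem inst_scons_up (t u : Tm) (σ : ℕ → Tm) :
    inst (scons u .var) (inst (up σ) t) = inst (scons u σ) t := by
  rw [inst_inst]
  congr 1
  funext k
  cases k with
  | zero => rfl
  | succ k =>
    simp only [Function.comp, up, inst_ren, scons]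
    exact inst_var _

theorem inst_inst_scons (t u : Tm) (σ : ℕ → Tm) :
    inst σ (inst (scons u .var) t) = inst (scons (inst σ u) .var) (inst (up σ) t) := by
  rw [inst_scons_up, inst_inst]
  congr 1
  funext k
  cases k <;> rfl

/-- β-reduction formulated with parallel substitution. -/
inductive Beta : Tm → Tm → Prop
  | beta {t u : Tm} : Beta (.app (.lam t) u) (inst (scons u .var) t)
  | appl {t t' u : Tm} : Beta t t' → Beta (.app t u) (.app t' u)
  | appr {t u u' : Tm} : Beta u u' → Beta (.app t u) (.app t u')
  | lam {t t' : Tm} : Beta t t' → Beta (.lam t) (.lam t')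

theorem Beta.inst {t t' : Tm} (h : Beta t t') (σ : ℕ → Tm) :
    Beta (inst σ t) (inst σ t') := by
  induction h generalizing σ with
  | beta => rw [inst_inst_scons]; exact .beta
  | appl _ ih => exact .appl (ih σ)
  | appr _ ih => exact .appr (ih σ)
  | lam _ ih => exact .lam (ih _)

theorem Pure.ren {t : Tm} (h : Pure t) (ξ : ℕ → ℕ) : Pure (ren ξ t) := by
  induction h generalizing ξ with
  | var => exact .var _
  | app _ _ ih₁ ih₂ => exact .app (ih₁ _) (ih₂ _)
  | lam _ ih => exact .lam (ih _)

theorem Pure.inst {t : Tm} (h : Pure t) {σ : ℕ → Tm} (hσ : ∀ k, Pure (σ k)) :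
    Pure (inst σ t) := by
  induction h generalizing σ with
  | var => exact hσ _
  | app _ _ ih₁ ih₂ => exact .app (ih₁ hσ) (ih₂ hσ)
  | lam _ ih =>
    refine .lam (ih fun k => ?_)
    cases k with
    | zero => exact .var 0
    | succ k => exact (hσ k).ren _

theorem Pure.liftshift_eq_ren {t : Tm} (h : Pure t) (i : ℕ) :
    liftshift i t = LambdaUpsilon.ren (fun k => if i ≤ k then k + 1 else k) t := by
  induction h generalizing i with
  | var k => simp only [liftshift, LambdaUpsilon.ren]; split <;> rfl
  | app _ _ ih₁ ih₂ => simp only [liftshift, LambdaUpsilon.ren, ih₁, ih₂]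
  | lam _ ih =>
    simp only [liftshift, LambdaUpsilon.ren, ih]
    congr 2
    funext k
    cases k <;> simp [upRen]
    split <;> rfl

theorem Pure.liftshift_zero {t : Tm} (h : Pure t) :
    liftshift 0 t = LambdaUpsilon.ren Nat.succ t := by
  simpa using h.liftshift_eq_ren 0

theorem Pure.shiftN {t : Tm} (h : Pure t) (i : ℕ) : Pure (shiftN i t) := by
  induction i with
  | zero => exact h
  | succ i ih =>
    rw [LambdaUpsilon.shiftN, Function.iterate_succ_apply', ← LambdaUpsilon.shiftN,
      ih.liftshift_zero]
    exact ih.ren _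

theorem Pure.bsub_eq_inst {t u : Tm} (h : Pure t) (hu : Pure u) (k : ℕ) :
    bsub k u t = LambdaUpsilon.inst (fun n =>
      if n = k then LambdaUpsilon.shiftN k u
      else if k < n then .var (n - 1) else .var n) t := by
  induction h generalizing k with
  | var => rfl
  | app _ _ ih₁ ih₂ => simp only [bsub, LambdaUpsilon.inst, ih₁, ih₂]
  | lam _ ih =>
    simp only [bsub, LambdaUpsilon.inst, ih]
    congr 2
    funext n
    cases n with
    | zero => simp [up]
    | succ n =>
      simp only [up, Nat.add_right_cancel_iff, Nat.add_lt_add_iff_right]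
      split_ifs
      · rw [LambdaUpsilon.shiftN, Function.iterate_succ_apply', ← LambdaUpsilon.shiftN,
          (hu.shiftN k).liftshift_zero]
      · obtain ⟨m, rfl⟩ : ∃ m, n = m + 1 := ⟨n - 1, by omega⟩
        rfl
      · rfl

theorem Pure.bsub_zero {t u : Tm} (h : Pure t) (hu : Pure u) :
    bsub 0 u t = LambdaUpsilon.inst (scons u .var) t := by
  rw [h.bsub_eq_inst hu]
  congr 1
  funext n
  cases n <;> rfl

theorem BetaP.beta_of_pure {t t' : Tm} (h : BetaP t t') (ht : Pure t) :
    Beta t t' ∧ Pure t' := by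
  induction h with
  | beta =>
    rcases ht with _ | ⟨_ | _ | ht, hu⟩
    rw [ht.bsub_zero hu]
    refine ⟨.beta, ht.inst fun k => ?_⟩
    cases k with
    | zero => exact hu
    | succ k => exact .var k
  | appl _ ih =>
    rcases ht with _ | ⟨ht, hu⟩
    exact ⟨.appl (ih ht).1, .app (ih ht).2 hu⟩
  | appr _ ih =>
    rcases ht with _ | ⟨ht, hu⟩
    exact ⟨.appr (ih hu).1, .app ht (ih hu).2⟩
  | lam _ ih =>
    rcases ht with _ | _ | ht
    exact ⟨.lam (ih ht).1, .lam (ih ht).2⟩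

theorem SN.betaP_of_pure {t : Tm} (h : SN Beta t) (ht : Pure t) : SN BetaP t := by
  induction h with
  | intro t _ ih =>
    exact ⟨_, fun t' h => ih t' (h.beta_of_pure ht).1 (h.beta_of_pure ht).2⟩

/-! ### Strong normalization of simply typed pure terms -/

/-- Reducible terms of a given type. -/
def Red : Ty → Tm → Prop
  | .base, t => SN Beta t
  | .arrow B A, t => ∀ u, Red B u → Red A (.app t u)

/-- Terms that are not abstractions. -/
def Neutral (t : Tm) : Prop := ∀ b, t ≠ .lam b

theorem SN.of_map {r : Tm → Tm → Prop} (f : Tm → Tm) (hf : ∀ {a b}, r a b → r (f a) (f b))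
    {t : Tm} (h : SN r (f t)) : SN r t :=
  Subrelation.accessible (r := InvImage (fun a b => r b a) f) (fun h => hf h)
    (InvImage.accessible f h)

theorem red_properties (A : Ty) :
    (∀ {t}, Red A t → SN Beta t) ∧ (∀ {t t'}, Red A t → Beta t t' → Red A t') ∧
      (∀ {t}, Neutral t → (∀ t', Beta t t' → Red A t') → Red A t) := by
  induction A with
  | base => exact ⟨id, fun h hs => h.inv hs, fun _ h => ⟨_, h⟩⟩
  | arrow B A ihB ihA =>
    refine ⟨fun {t} ht => ?_, fun ht hs u hu => ihA.2.1 (ht u hu) (.appl hs),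
      fun {t} hn ht u hu => ?_⟩
    · have hv : Red B (.var 0) := ihB.2.2 (fun _ h => by cases h) (fun _ h => by cases h)
      exact SN.of_map (Tm.app · (.var 0)) .appl (ihA.1 (ht _ hv))
    · have hsn := ihB.1 hu
      induction hsn with
      | intro u _ ih =>
        refine ihA.2.2 (fun _ h => by cases h) fun t' hs => ?_
        cases hs with
        | beta => exact absurd rfl (hn _)
        | appl hs => exact ht _ hs u hu
        | appr hs => exact ih _ hs (ihB.2.1 hu hs)

theorem Red.sn {A : Ty} {t : Tm} (h : Red A t) : SN Beta t := (red_properties A).1 h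

theorem Red.beta {A : Ty} {t t' : Tm} (h : Red A t) (hs : Beta t t') : Red A t' :=
  (red_properties A).2.1 h hs

theorem Red.of_neutral {A : Ty} {t : Tm} (hn : Neutral t)
    (h : ∀ t', Beta t t' → Red A t') : Red A t :=
  (red_properties A).2.2 hn h

theorem Red.var (A : Ty) (k : ℕ) : Red A (.var k) :=
  .of_neutral (fun _ h => by cases h) (fun _ h => by cases h)

theorem Red.lam {A B : Ty} {b : Tm} (h : ∀ u, Red B u → Red A (inst (scons u .var) b)) :
    Red (.arrow B A) (.lam b) := by
  intro u hu
  have hb : SN Beta b := SN.of_map _ (fun h => h.inst _) (h _ (.var B 0)).sn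
  induction hb generalizing u with
  | intro b _ ihb =>
    have hsn := hu.sn
    induction hsn with
    | intro u _ ihu =>
      refine .of_neutral (fun _ h => by cases h) fun t' hs => ?_
      cases hs with
      | beta => exact h u hu
      | appl hs =>
        cases hs with
        | lam hs => exact ihb _ hs (fun v hv => (h v hv).beta (hs.inst _)) u hu
      | appr hs => exact ihu _ hs (hu.beta hs)

theorem Pure.red_inst {t : Tm} (ht : Pure t) {Γ : List Ty} {A : Ty} (h : TypT Γ t A)
    {σ : ℕ → Tm} (hσ : ∀ k B, Γ[k]? = some B → Red B (σ k)) :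
    Red A (LambdaUpsilon.inst σ t) := by
  induction ht generalizing Γ A σ with
  | var => cases h with | var hk => exact hσ _ _ hk
  | app _ _ ih₁ ih₂ => cases h with | app h₁ h₂ => exact ih₁ h₁ hσ _ (ih₂ h₂ hσ)
  | lam _ ih =>
    cases h with
    | lam h =>
      refine .lam fun u hu => ?_
      rw [inst_scons_up]
      refine ih h ?_
      rintro (_ | k) B hk
      · cases hk; exact hu
      · exact hσ k B hk

theorem Pure.sn_of_typT {t : Tm} (ht : Pure t) {Γ : List Ty} {A : Ty} (h : TypT Γ t A) :
    SN BetaP t := by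
  have := (ht.red_inst h fun k B _ => .var B k).sn
  rw [inst_var] at this
  exact this.betaP_of_pure ht

theorem SN.steps {r : Tm → Tm → Prop} {t t' : Tm} (h : SN r t) (hs : ReflTransGen r t t') :
    SN r t' := by
  induction hs with
  | refl => exact h
  | tail _ hs ih => exact ih.inv hs

/-- If λυ preserves strong normalization (PSN), then every simply typed
λυ-term is strongly normalizing for λυ-reduction. -/
theorem SN_of_PSN
    (PSN : ∀ t : Tm, Pure t → SN BetaP t → SN Step t) :
    ∀ (Γ : List Ty) (t : Tm) (A : Ty), TypT Γ t A → SN Step t := by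
  intro Γ t A h
  obtain ⟨u, ⟨p, hp, ht, hs⟩, hu⟩ := h.exists_sim (Δ := Γ) (ρ := id) fun _ _ hk => hk
  exact ((PSN p hp (hp.sn_of_typT ht)).steps hs).of_sim hu

end LambdaUpsilon
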